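/- arXiv:2306.08470 — 2 statements merged into one kernel-verified Lean document; each statement's English description precedes it below -/
import Mathlib

section
/- Lemma (uniform-prefix Azuma-type bound for Lagrangian payoffs with predictable multipliers, Lemma 4.1, inequality (HoefEmpty3)). With probability at least 1 − δ/2, simultaneously for every K ∈ {0,1,…,T}, it holds that ∑_{t=1}^K ( F_t + ⟨λ_t, ρ·𝟙 − C_t⟩ ) ≥ ∑_{t=1}^K ( μ_f + ⟨λ_t, ρ·𝟙 − μ_c⟩ ) − (1 + 2M)·√(2·T·log(4T/δ)). -/
open MeasureTheory

lemma exp_chord (s c x : ℝ) (hc : 0 < c) (hx : |x| ≤ c) :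
    Real.exp (s * x) ≤ Real.cosh (s * c) + x * (Real.sinh (s * c) / c) := by
  obtain ⟨h1, h2⟩ := abs_le.mp hx
  have h := convexOn_exp.2 (Set.mem_univ (s * c)) (Set.mem_univ (-(s * c)))
    (div_nonneg (by linarith) (by linarith) : 0 ≤ (c + x) / (2 * c))
    (div_nonneg (by linarith) (by linarith) : 0 ≤ (c - x) / (2 * c))
    (by field_simp; ring)
  simp only [smul_eq_mul] at h
  have e1 : (c + x) / (2 * c) * (s * c) + (c - x) / (2 * c) * -(s * c) = s * x := by
    field_simp; ring
  rw [e1] at h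
  refine h.trans (le_of_eq ?_)
  rw [Real.cosh_eq, Real.sinh_eq]
  field_simp; ring

lemma integral_mul_eq_zero_of_condExp {Ω : Type*} {m0 : MeasurableSpace Ω}
    (μ : Measure Ω) [IsProbabilityMeasure μ] (m1 : MeasurableSpace Ω) (hm1 : m1 ≤ m0)
    (Z D : Ω → ℝ) (hZ : Measurable[m1] Z) (hZD : Integrable (fun ω => Z ω * D ω) μ)
    (hD : Integrable D μ) (h0 : μ[D | m1] =ᵐ[μ] fun _ => 0) :
    ∫ ω, Z ω * D ω ∂μ = 0 := by
  have h := condExp_mul_of_stronglyMeasurable_left (μ := μ) (hZ.stronglyMeasurable) hZD hD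
  rw [← integral_condExp hm1]
  have : μ[fun ω => Z ω * D ω | m1] =ᵐ[μ] fun _ => 0 := by
    filter_upwards [h, h0] with ω h1 h2
    refine h1.trans ?_
    simp [h2]
  rw [integral_congr_ae this]; simp

lemma azuma_mgf {Ω : Type*} {m0 : MeasurableSpace Ω}
    (μ : Measure Ω) [IsProbabilityMeasure μ] (T : ℕ) (c s : ℝ) (hc : 0 < c)
    (ℱ : Filtration ℕ m0) (D : ℕ → Ω → ℝ)
    (hDm : ∀ t ∈ Finset.Icc 1 T, Measurable[ℱ t] (D t))
    (hDb : ∀ t ∈ Finset.Icc 1 T, ∀ᵐ ω ∂μ, |D t ω| ≤ c)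
    (hD0 : ∀ t ∈ Finset.Icc 1 T, μ[D t | ℱ (t - 1)] =ᵐ[μ] fun _ => 0)
    (K : ℕ) (hK : K ≤ T) :
    Measurable[ℱ K] (fun ω => Real.exp (s * ∑ t ∈ Finset.Icc 1 K, D t ω)) ∧
    Integrable (fun ω => Real.exp (s * ∑ t ∈ Finset.Icc 1 K, D t ω)) μ ∧
    ∫ ω, Real.exp (s * ∑ t ∈ Finset.Icc 1 K, D t ω) ∂μ ≤ Real.exp (K * ((s * c) ^ 2 / 2)) := by
  induction K with
  | zero => simp
  | succ K ih =>
    obtain ⟨ihm, ihi, ihb⟩ := ih (by omega)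
    have hmem : K + 1 ∈ Finset.Icc 1 T := Finset.mem_Icc.mpr ⟨by omega, hK⟩
    have hdm := hDm _ hmem
    have hdb := hDb _ hmem
    have hd0 := hD0 _ hmem
    rw [Nat.add_sub_cancel] at hd0
    have hdm0 : Measurable (D (K + 1)) := hdm.mono (ℱ.le _) le_rfl
    have hdi : Integrable (D (K + 1)) μ :=
      Integrable.of_bound hdm0.aestronglyMeasurable c (by simpa using hdb)
    have hsplit : (fun ω => Real.exp (s * ∑ t ∈ Finset.Icc 1 (K + 1), D t ω)) =
        fun ω => Real.exp (s * ∑ t ∈ Finset.Icc 1 K, D t ω) * Real.exp (s * D (K + 1) ω) := by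
      funext ω
      rw [Finset.sum_Icc_succ_top (by omega), mul_add, Real.exp_add]
    rw [hsplit]
    set Z := fun ω => Real.exp (s * ∑ t ∈ Finset.Icc 1 K, D t ω) with hZ
    have hem : Measurable[ℱ (K + 1)] (fun ω => Real.exp (s * D (K + 1) ω)) :=
      Real.measurable_exp.comp (hdm.const_mul s)
    have hZD : Integrable (fun ω => Z ω * D (K + 1) ω) μ :=
      ihi.mul_bdd (c := c) hdm0.aestronglyMeasurable (by simpa using hdb)
    have hZe : Integrable (fun ω => Z ω * Real.exp (s * D (K + 1) ω)) μ := by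
      refine ihi.mul_bdd (c := Real.exp (|s| * c))
        (hem.mono (ℱ.le _) le_rfl).aestronglyMeasurable ?_
      filter_upwards [hdb] with ω h
      rw [Real.norm_eq_abs, Real.abs_exp]
      refine Real.exp_le_exp.mpr ((le_abs_self _).trans ?_)
      rw [abs_mul]
      exact mul_le_mul_of_nonneg_left h (abs_nonneg _)
    refine ⟨(ihm.mono (ℱ.mono (Nat.le_succ K)) le_rfl).mul hem, hZe, ?_⟩
    have hz := integral_mul_eq_zero_of_condExp μ (ℱ K) (ℱ.le _) Z _ ihm hZD hdi hd0
    calc ∫ ω, Z ω * Real.exp (s * D (K + 1) ω) ∂μ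
        ≤ ∫ ω, (Z ω * Real.cosh (s * c) + (Z ω * D (K + 1) ω) * (Real.sinh (s * c) / c)) ∂μ := by
          refine integral_mono_ae hZe ((ihi.mul_const _).add (hZD.mul_const _)) ?_
          filter_upwards [hdb] with ω h
          have := mul_le_mul_of_nonneg_left (exp_chord s c _ hc h) (Real.exp_pos
            (s * ∑ t ∈ Finset.Icc 1 K, D t ω)).le
          simp only [hZ]
          linarith
      _ = (∫ ω, Z ω ∂μ) * Real.cosh (s * c) := by
          rw [integral_add (ihi.mul_const _) (hZD.mul_const _), integral_mul_const,
            integral_mul_const, hz]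
          ring
      _ ≤ Real.exp (K * ((s * c) ^ 2 / 2)) * Real.exp ((s * c) ^ 2 / 2) :=
          mul_le_mul ihb (Real.cosh_le_exp_half_sq _) (Real.cosh_pos _).le (Real.exp_pos _).le
      _ = _ := by
          rw [← Real.exp_add]; congr 1; push_cast; ring

lemma azuma_tail {Ω : Type*} {m0 : MeasurableSpace Ω}
    (μ : Measure Ω) [IsProbabilityMeasure μ] (T : ℕ) (hT : 1 ≤ T) (c L : ℝ) (hc : 0 < c)
    (hL : 0 ≤ L)
    (ℱ : Filtration ℕ m0) (D : ℕ → Ω → ℝ)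
    (hDm : ∀ t ∈ Finset.Icc 1 T, Measurable[ℱ t] (D t))
    (hDb : ∀ t ∈ Finset.Icc 1 T, ∀ᵐ ω ∂μ, |D t ω| ≤ c)
    (hD0 : ∀ t ∈ Finset.Icc 1 T, μ[D t | ℱ (t - 1)] =ᵐ[μ] fun _ => 0)
    (K : ℕ) (hK : K ≤ T) :
    μ {ω | c * Real.sqrt (2 * T * L) ≤ ∑ t ∈ Finset.Icc 1 K, D t ω} ≤
      ENNReal.ofReal (Real.exp (-L)) := by
  have hTr : (0 : ℝ) < T := by exact_mod_cast hT
  set r := Real.sqrt (2 * T * L) with hr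
  have hr2 : r ^ 2 = 2 * T * L := Real.sq_sqrt (by positivity)
  set s := r / (c * T) with hs
  have hs0 : 0 ≤ s := div_nonneg (Real.sqrt_nonneg _) (by positivity)
  obtain ⟨-, hi, hb⟩ := azuma_mgf μ T c s hc ℱ D hDm hDb hD0 K hK
  have hch := ProbabilityTheory.measure_ge_le_exp_mul_mgf (μ := μ)
    (X := fun ω => ∑ t ∈ Finset.Icc 1 K, D t ω) (c * r) hs0 hi
  rw [← ofReal_measureReal]
  refine ENNReal.ofReal_le_ofReal (hch.trans ?_)
  calc _ ≤ Real.exp (-s * (c * r)) * Real.exp (K * ((s * c) ^ 2 / 2)) :=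
        mul_le_mul_of_nonneg_left hb (Real.exp_pos _).le
    _ ≤ Real.exp (-s * (c * r)) * Real.exp (T * ((s * c) ^ 2 / 2)) := by
        gcongr
    _ = _ := by
        rw [← Real.exp_add]; congr 1
        have e1 : s * c = r / T := by rw [hs]; field_simp
        have : -s * (c * r) + T * ((s * c) ^ 2 / 2) = -(s * c) * r + T * ((s * c) ^ 2 / 2) := by
          ring
        rw [this, e1]
        have : -(r / T) * r + T * ((r / T) ^ 2 / 2) = - r ^ 2 / (2 * T) := by
          field_simp; ring
        rw [this, hr2]; field_simp

/-- Lemma 4.1, inequality (HoefEmpty3) (uniform-prefix Azuma-type bound for Lagrangian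
payoffs with predictable multipliers). With probability at least `1 − δ/2`, simultaneously
for every `K ∈ {0,…,T}`,
`∑_{t=1}^K (F_t + ⟨λ_t, ρ𝟙 − C_t⟩) ≥ ∑_{t=1}^K (μ_f + ⟨λ_t, ρ𝟙 − μ_c⟩) − (1+2M)·√(2T·log(4T/δ))`. -/
theorem stmt_7 {Ω : Type*} [m0 : MeasurableSpace Ω]
    (μ : Measure Ω) [IsProbabilityMeasure μ]
    (T m : ℕ) (hT : 1 ≤ T) (hm : 1 ≤ m)
    (M ρ δ : ℝ) (hM : 0 ≤ M) (hρ0 : 0 < ρ) (hρ1 : ρ ≤ 1) (hδ0 : 0 < δ) (hδ1 : δ ≤ 1)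
    (ℱ : Filtration ℕ m0)
    (lam : ℕ → Ω → Fin m → ℝ) (F : ℕ → Ω → ℝ) (C : ℕ → Ω → Fin m → ℝ)
    (μf : ℝ) (μc : Fin m → ℝ)
    (hμf0 : 0 ≤ μf) (hμf1 : μf ≤ 1) (hμc : ∀ i, |μc i| ≤ 1)
    -- λ_t is F_{t−1}-measurable, nonnegative, with ‖λ_t‖₁ ≤ M a.s.
    (hlam_meas : ∀ t ∈ Finset.Icc 1 T, ∀ i, Measurable[ℱ (t - 1)] (fun ω => lam t ω i))
    (hlam_nonneg : ∀ t ∈ Finset.Icc 1 T, ∀ᵐ ω ∂μ, ∀ i, 0 ≤ lam t ω i)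
    (hlam_bdd : ∀ t ∈ Finset.Icc 1 T, ∀ᵐ ω ∂μ, (∑ i, lam t ω i) ≤ M)
    -- F_t is F_t-measurable with values in [0,1]
    (hF_meas : ∀ t ∈ Finset.Icc 1 T, Measurable[ℱ t] (F t))
    (hF_bdd : ∀ t ∈ Finset.Icc 1 T, ∀ᵐ ω ∂μ, 0 ≤ F t ω ∧ F t ω ≤ 1)
    -- C_t is F_t-measurable with values in [−1,1]^m
    (hC_meas : ∀ t ∈ Finset.Icc 1 T, ∀ i, Measurable[ℱ t] (fun ω => C t ω i))
    (hC_bdd : ∀ t ∈ Finset.Icc 1 T, ∀ᵐ ω ∂μ, ∀ i, |C t ω i| ≤ 1)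
    -- constant conditional means
    (hcondF : ∀ t ∈ Finset.Icc 1 T, μ[F t | ℱ (t - 1)] =ᵐ[μ] fun _ => μf)
    (hcondC : ∀ t ∈ Finset.Icc 1 T, ∀ i,
      μ[(fun ω => C t ω i) | ℱ (t - 1)] =ᵐ[μ] fun _ => μc i) :
    ENNReal.ofReal (1 - δ / 2) ≤
      μ {ω | ∀ K ≤ T,
        ∑ t ∈ Finset.Icc 1 K, (F t ω + ∑ i, lam t ω i * (ρ - C t ω i)) ≥
          (∑ t ∈ Finset.Icc 1 K, (μf + ∑ i, lam t ω i * (ρ - μc i)))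
            - (1 + 2 * M) * Real.sqrt (2 * T * Real.log (4 * T / δ))} := by
  classical
  have hTr : (1 : ℝ) ≤ T := by exact_mod_cast hT
  set D : ℕ → Ω → ℝ := fun t ω => (μf - F t ω) + ∑ i, lam t ω i * (C t ω i - μc i) with hD
  set c := 1 + 2 * M with hcdef
  have hc : 0 < c := by positivity
  set L := Real.log (4 * T / δ) with hLdef
  have hq : 1 ≤ 4 * T / δ := by rw [le_div_iff₀ hδ0]; linarith
  have hL : 0 ≤ L := Real.log_nonneg hq
  have hlam_le : ∀ t ∈ Finset.Icc 1 T, ∀ᵐ ω ∂μ, ∀ i, |lam t ω i| ≤ M := by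
    intro t ht
    filter_upwards [hlam_nonneg t ht, hlam_bdd t ht] with ω h1 h2 i
    rw [abs_of_nonneg (h1 i)]
    exact (Finset.single_le_sum (fun j _ => h1 j) (Finset.mem_univ i)).trans h2
  have hDm : ∀ t ∈ Finset.Icc 1 T, Measurable[ℱ t] (D t) := by
    intro t ht
    refine (measurable_const.sub (hF_meas t ht)).add (Finset.measurable_fun_sum _ fun i _ => ?_)
    exact ((hlam_meas t ht i).mono (ℱ.mono (Nat.sub_le _ _)) le_rfl).mul
      ((hC_meas t ht i).sub measurable_const)
  have hDb : ∀ t ∈ Finset.Icc 1 T, ∀ᵐ ω ∂μ, |D t ω| ≤ c := by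
    intro t ht
    filter_upwards [hlam_nonneg t ht, hlam_bdd t ht, hF_bdd t ht, hC_bdd t ht] with ω h1 h2 h3 h4
    have ha : |μf - F t ω| ≤ 1 := abs_le.mpr ⟨by linarith, by linarith⟩
    have hb : |∑ i, lam t ω i * (C t ω i - μc i)| ≤ 2 * M := by
      calc _ ≤ ∑ i, |lam t ω i * (C t ω i - μc i)| := Finset.abs_sum_le_sum_abs _ _
        _ ≤ ∑ i, lam t ω i * 2 := by
            refine Finset.sum_le_sum fun i _ => ?_
            rw [abs_mul, abs_of_nonneg (h1 i)]
            refine mul_le_mul_of_nonneg_left ?_ (h1 i)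
            have := abs_sub (C t ω i) (μc i)
            linarith [h4 i, hμc i]
        _ = (∑ i, lam t ω i) * 2 := by rw [Finset.sum_mul]
        _ ≤ _ := by linarith
    exact (abs_add_le _ _).trans (by linarith)
  have hD0 : ∀ t ∈ Finset.Icc 1 T, μ[D t | ℱ (t - 1)] =ᵐ[μ] fun _ => 0 := by
    intro t ht
    have hFi : Integrable (F t) μ :=
      Integrable.of_bound ((hF_meas t ht).mono (ℱ.le _) le_rfl).aestronglyMeasurable 1 (by
        filter_upwards [hF_bdd t ht] with ω h
        rw [Real.norm_eq_abs, abs_of_nonneg h.1]; exact h.2)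
    have hCi : ∀ i, Integrable (fun ω => C t ω i) μ := fun i =>
      Integrable.of_bound ((hC_meas t ht i).mono (ℱ.le _) le_rfl).aestronglyMeasurable 1 (by
        filter_upwards [hC_bdd t ht] with ω h using h i)
    have hCi' : ∀ i, Integrable (fun ω => C t ω i - μc i) μ := fun i =>
      (hCi i).sub (integrable_const _)
    have hlCi : ∀ i, Integrable (fun ω => lam t ω i * (C t ω i - μc i)) μ := fun i =>
      (hCi' i).bdd_mul (c := M) ((hlam_meas t ht i).mono (ℱ.le _) le_rfl).aestronglyMeasurable (by
        filter_upwards [hlam_le t ht] with ω h using h i)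
    have k1 : μ[fun ω => μf - F t ω | ℱ (t - 1)] =ᵐ[μ] fun _ => 0 := by
      have h := condExp_sub (μ := μ) (integrable_const μf) hFi (ℱ (t - 1))
      rw [condExp_const (ℱ.le _)] at h
      filter_upwards [h, hcondF t ht] with ω h1 h2
      refine h1.trans ?_
      simp [h2]
    have k2 : ∀ i, μ[fun ω => C t ω i - μc i | ℱ (t - 1)] =ᵐ[μ] fun _ => 0 := by
      intro i
      have h := condExp_sub (μ := μ) (hCi i) (integrable_const (μc i)) (ℱ (t - 1))
      rw [condExp_const (ℱ.le _)] at h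
      filter_upwards [h, hcondC t ht i] with ω h1 h2
      refine h1.trans ?_
      simp [h2]
    have k3 : ∀ i, μ[fun ω => lam t ω i * (C t ω i - μc i) | ℱ (t - 1)] =ᵐ[μ] fun _ => 0 := by
      intro i
      have h := condExp_mul_of_stronglyMeasurable_left (μ := μ)
        ((hlam_meas t ht i).stronglyMeasurable) (hlCi i) (hCi' i)
      filter_upwards [h, k2 i] with ω h1 h2
      refine h1.trans ?_
      simp [h2]
    have k4 : μ[∑ i, fun ω => lam t ω i * (C t ω i - μc i) | ℱ (t - 1)] =ᵐ[μ] fun _ => 0 := by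
      have h := condExp_finsetSum (μ := μ) (s := Finset.univ) (fun i _ => hlCi i) (ℱ (t - 1))
      filter_upwards [h, ae_all_iff.mpr k3] with ω h1 h2
      refine h1.trans ?_
      simp [h2]
    have hDe : D t = (fun ω => μf - F t ω) + ∑ i, fun ω => lam t ω i * (C t ω i - μc i) := by
      funext ω; simp [hD]
    rw [hDe]
    have h := condExp_add (μ := μ) ((integrable_const μf).sub hFi)
      (integrable_finsetSum' Finset.univ (fun i _ => hlCi i)) (ℱ (t - 1))
    filter_upwards [h, k1, k4] with ω h1 h2 h3
    refine h1.trans ?_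
    rw [Pi.add_apply, h3, add_zero]
    exact h2
  set A := {ω | ∀ K ≤ T,
        ∑ t ∈ Finset.Icc 1 K, (F t ω + ∑ i, lam t ω i * (ρ - C t ω i)) ≥
          (∑ t ∈ Finset.Icc 1 K, (μf + ∑ i, lam t ω i * (ρ - μc i)))
            - c * Real.sqrt (2 * T * L)} with hA
  have hsub : Aᶜ ⊆ ⋃ K ∈ Finset.Icc 1 T,
      {ω | c * Real.sqrt (2 * T * L) ≤ ∑ t ∈ Finset.Icc 1 K, D t ω} := by
    intro ω hω
    simp only [hA, Set.mem_compl_iff, Set.mem_ofPred_eq, not_forall, not_le, ge_iff_le] at hω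
    obtain ⟨K, hK, h⟩ := hω
    have hK1 : 1 ≤ K := by
      by_contra h0
      have : K = 0 := by omega
      subst this
      simp only [Finset.Icc_eq_empty_of_lt Nat.zero_lt_one, Finset.sum_empty] at h
      have : 0 ≤ c * Real.sqrt (2 * T * L) := by positivity
      linarith
    simp only [Set.mem_iUnion, Set.mem_ofPred_eq]
    refine ⟨K, Finset.mem_Icc.mpr ⟨hK1, hK⟩, ?_⟩
    have e : ∑ t ∈ Finset.Icc 1 K, D t ω =
        (∑ t ∈ Finset.Icc 1 K, (μf + ∑ i, lam t ω i * (ρ - μc i))) -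
        ∑ t ∈ Finset.Icc 1 K, (F t ω + ∑ i, lam t ω i * (ρ - C t ω i)) := by
      rw [← Finset.sum_sub_distrib]
      refine Finset.sum_congr rfl fun t _ => ?_
      have : ∑ i, lam t ω i * (C t ω i - μc i) =
          ∑ i, lam t ω i * (ρ - μc i) - ∑ i, lam t ω i * (ρ - C t ω i) := by
        rw [← Finset.sum_sub_distrib]
        exact Finset.sum_congr rfl fun i _ => by ring
      simp only [hD, this]; ring
    rw [e]; linarith
  have hexp : Real.exp (-L) = δ / (4 * T) := by
    rw [Real.exp_neg, hLdef, Real.exp_log (by linarith), inv_div]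
  have hcompl : μ Aᶜ ≤ ENNReal.ofReal (δ / 2) := by
    calc μ Aᶜ ≤ _ := measure_mono hsub
      _ ≤ ∑ K ∈ Finset.Icc 1 T,
          μ {ω | c * Real.sqrt (2 * T * L) ≤ ∑ t ∈ Finset.Icc 1 K, D t ω} :=
          measure_biUnion_finset_le _ _
      _ ≤ ∑ K ∈ Finset.Icc 1 T, ENNReal.ofReal (Real.exp (-L)) :=
          Finset.sum_le_sum fun K hK =>
            azuma_tail μ T hT c L hc hL ℱ D hDm hDb hD0 K (Finset.mem_Icc.mp hK).2
      _ = ENNReal.ofReal (T * (δ / (4 * T))) := by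
          rw [hexp, Finset.sum_const, Nat.card_Icc, nsmul_eq_mul,
            ENNReal.ofReal_mul (by positivity), ENNReal.ofReal_natCast]
          simp
      _ ≤ _ := by
          refine ENNReal.ofReal_le_ofReal ?_
          have : (T : ℝ) * (δ / (4 * T)) = δ / 4 := by field_simp
          linarith
  have h1 : (1 : ENNReal) ≤ μ A + μ Aᶜ := by
    rw [← measure_univ (μ := μ), ← Set.union_compl_self A]
    exact measure_union_le _ _
  rw [ENNReal.ofReal_sub _ (by positivity), ENNReal.ofReal_one]
  exact tsub_le_iff_right.mpr (h1.trans (by gcongr))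
end

section
/- Corollary (adversarial guarantee with unknown replenishment factor, Corollary 5.5, adversarial case). There exist absolute constants k₁, k₂, k₃ > 0 such that the following holds. Suppose the dual multipliers (λ_t)_{t∈T_G} are produced by online gradient ascent on ℝ_{≥0}^m run on the subsequence of rounds in T_G: at the first round of T_G the multiplier is 0, and if t, t' are consecutive rounds of T_G then λ_{t',i} = max(0, λ_{t,i} + η·(c_{t,i}(x_t) − ρ)) for each i ∈ [m], with step size η = ( k₁·E + k₂·m·E_P + 2m·√T )^{−1} for some E ≥ 0 and E_P ≥ 0. Suppose the primal satisfies the weakly-adaptive regret guarantee with unknown payoff range (Assumption 5.1): for every interval I of consecutive rounds of T_G and every L > 0 bounding |f_t(x) + ⟨λ_t, ρ·𝟙 − c_t(x)⟩| ≤ L for all x ∈ X and t ∈ I, it holds that for every x ∈ X and p ∈ [0,1], p·∑_{t∈I} L_t(x) + (1−p)·∑_{t∈I} L_t(x₀) − ∑_{t∈I} L_t(x_t) ≤ L²·E_P. Then, with α := ν/(1+β), ∑_{t=1}^T f_t(x_t) ≥ α · sup_{x∈X} ∑_{t=1}^T f_t(x) − k₃·(m⁴/ν²)·( E_P + E + √T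 ). -/
/-- The multiplier state before round `t`, extended to all rounds. -/
noncomputable def ogdState {m : ℕ} (η : ℝ) (G : ℕ → Fin m → ℝ) : ℕ → Fin m → ℝ
  | 0 => fun _ => 0
  | t + 1 => fun i => max 0 (ogdState η G t i + η * G t i)

lemma ogdState_nonneg {m : ℕ} (η : ℝ) (G : ℕ → Fin m → ℝ) (t : ℕ) (i : Fin m) :
    0 ≤ ogdState η G t i := by
  cases t with
  | zero => simp [ogdState]
  | succ t => simp [ogdState]

lemma ogd_step1 (a u g η : ℝ) (hu : 0 ≤ u) (hg : |g| ≤ 2) :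
    (max 0 (a + η * g) - u) ^ 2 ≤ (a - u) ^ 2 + 2 * η * ((a - u) * g) + 4 * η ^ 2 := by
  have h1 : (max 0 (a + η * g) - u) ^ 2 ≤ (a + η * g - u) ^ 2 := by
    rcases le_total 0 (a + η * g) with h | h
    · rw [max_eq_right h]
    · rw [max_eq_left h]
      nlinarith
  have h2 : g ^ 2 ≤ 4 := by
    have := abs_le.1 hg
    nlinarith
  nlinarith [mul_le_mul_of_nonneg_left h2 (sq_nonneg η)]

lemma ogd_step {m : ℕ} (η : ℝ) (G : ℕ → Fin m → ℝ) (hG : ∀ t i, |G t i| ≤ 2)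
    (u : Fin m → ℝ) (hu : ∀ i, 0 ≤ u i) (t : ℕ) :
    ∑ i, (ogdState η G (t + 1) i - u i) ^ 2 ≤
      ∑ i, (ogdState η G t i - u i) ^ 2
        + 2 * η * ∑ i, (ogdState η G t i - u i) * G t i + 4 * m * η ^ 2 := by
  have h : ∀ i, (ogdState η G (t + 1) i - u i) ^ 2 ≤
      (ogdState η G t i - u i) ^ 2
        + 2 * η * ((ogdState η G t i - u i) * G t i) + 4 * η ^ 2 :=
    fun i => ogd_step1 _ _ _ _ (hu i) (hG t i)
  have := Finset.sum_le_sum (fun i (_ : i ∈ Finset.univ) => h i)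
  rw [Finset.sum_add_distrib, Finset.sum_add_distrib, ← Finset.mul_sum] at this
  simp only [Finset.sum_const, Finset.card_univ, Fintype.card_fin, nsmul_eq_mul] at this
  linarith

lemma ogd_sum {m : ℕ} (η : ℝ) (G : ℕ → Fin m → ℝ) (hG : ∀ t i, |G t i| ≤ 2)
    (u : Fin m → ℝ) (hu : ∀ i, 0 ≤ u i) (a b : ℕ) (hab : a ≤ b) :
    ∑ i, (ogdState η G b i - u i) ^ 2 ≤
      ∑ i, (ogdState η G a i - u i) ^ 2
        + 2 * η * ∑ t ∈ Finset.Ico a b, ∑ i, (ogdState η G t i - u i) * G t i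
        + 4 * m * η ^ 2 * ((b : ℝ) - a) := by
  induction b, hab using Nat.le_induction with
  | base => simp
  | succ b hab ih =>
    rw [Finset.sum_Ico_succ_top hab]
    have := ogd_step η G hG u hu b
    push_cast
    linarith

/-- The extended state agrees with the multipliers on the rounds of `TG`. -/
lemma ogd_agree {m : ℕ} (η : ℝ) (g G : ℕ → Fin m → ℝ) (TG : Finset ℕ) (lam : ℕ → Fin m → ℝ)
    (hG : ∀ t i, G t i = if t ∈ TG then g t i else 0)
    (h0 : ∀ t ∈ TG, (∀ s ∈ TG, t ≤ s) → ∀ i, lam t i = 0)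
    (h1 : ∀ t ∈ TG, ∀ t' ∈ TG, t < t' → (∀ s ∈ TG, s ≤ t ∨ t' ≤ s) →
          ∀ i, lam t' i = max 0 (lam t i + η * g t i)) (n : ℕ) (hn : n ∈ TG) (i : Fin m) :
    lam n i = ogdState η G n i := by
  have inv : ∀ n : ℕ, ((∀ s ∈ TG, n ≤ s) ∧ ∀ i, ogdState η G n i = 0) ∨
      (∃ s ∈ TG, s < n ∧ (∀ r ∈ TG, r ≤ s ∨ n ≤ r) ∧
        ∀ i, ogdState η G n i = max 0 (lam s i + η * g s i)) := by
    intro n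
    induction n with
    | zero => left; simp [ogdState]
    | succ n ih =>
      by_cases hn : n ∈ TG
      · right
        refine ⟨n, hn, Nat.lt_succ_self n, fun r _ => by omega, fun i => ?_⟩
        have : lam n i = ogdState η G n i := by
          rcases ih with ⟨ha, hb⟩ | ⟨s, hs, hsn, hr, hb⟩
          · rw [h0 n hn ha, hb]
          · rw [h1 s hs n hn hsn hr, hb]
        simp [ogdState, hG, hn, this]
      · have hst : ∀ i, ogdState η G (n + 1) i = ogdState η G n i := by
          intro i
          simp [ogdState, hG, hn, ogdState_nonneg]
        have hne : ∀ r ∈ TG, r ≠ n := fun r hr h => hn (h ▸ hr)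
        rcases ih with ⟨ha, hb⟩ | ⟨s, hs, hsn, hr, hb⟩
        · left
          refine ⟨fun s hs => ?_, fun i => by rw [hst, hb]⟩
          have := ha s hs
          have := hne s hs
          omega
        · right
          refine ⟨s, hs, by omega, fun r hr' => ?_, fun i => by rw [hst, hb]⟩
          have := hr r hr'
          have := hne r hr'
          omega
  rcases inv n with ⟨ha, hb⟩ | ⟨s, hs, hsn, hr, hb⟩
  · rw [h0 n hn ha, hb]
  · rw [h1 s hs n hn hsn hr, hb]

lemma ogd_arith (m η EP T w s q : ℝ) (hm' : 1 ≤ m)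
    (hη1 : 2 * η ≤ 1) (hηE : 100 * m * (η * EP) ≤ 1) (hηT : 4 * m * (m * η ^ 2 * T) ≤ m)
    (hw : 1 ≤ 4 * w) (hw0 : 0 < w) (hcs : s ^ 2 ≤ m * q)
    (hmain : q ≤ w + 2 * η * (100 * m ^ 2 * w * EP + 1) + 4 * m * η ^ 2 * T) :
    s ^ 2 ≤ 16 * m ^ 2 * w := by
  have h4 := mul_le_mul_of_nonneg_left hmain (by positivity : (0 : ℝ) ≤ m)
  have h5 := mul_le_mul_of_nonneg_left hηE (by positivity : (0 : ℝ) ≤ 2 * (m ^ 2 * w))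
  have h6 := mul_le_mul_of_nonneg_left hη1 (by positivity : (0 : ℝ) ≤ m)
  have h7 := mul_le_mul_of_nonneg_left hw (by positivity : (0 : ℝ) ≤ m)
  have h8 : m * w ≤ m ^ 2 * w :=
    mul_le_mul_of_nonneg_right (le_self_pow₀ hm' two_ne_zero) hw0.le
  have h9 : 0 ≤ m ^ 2 * w := by positivity
  linarith

/-- Boundedness of the multipliers. -/
lemma ogd_bound {m : ℕ} (hm : 1 ≤ m) (η ν EP : ℝ) (T : ℕ) (hη : 0 ≤ η) (hν : 0 < ν) (hν2 : ν ≤ 2)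
    (hη1 : 2 * η ≤ 1) (hηE : 100 * m * (η * EP) ≤ 1) (hηT : 4 * m * (m * η ^ 2 * T) ≤ m)
    (G : ℕ → Fin m → ℝ) (hG : ∀ t i, |G t i| ≤ 2)
    (hz : ∀ i, ogdState η G 1 i = 0)
    (hreg : ∀ a b : ℕ, 1 ≤ a → a ≤ b → b ≤ T →
      (∀ t ∈ Finset.Icc a b, ∑ i, ogdState η G t i ≤ 4 * m / ν) →
      (∀ t ∈ Finset.Icc a b, a < t → 1 < ν * ∑ i, ogdState η G t i) →
      ∑ t ∈ Finset.Icc a b, ∑ i, ogdState η G t i * G t i ≤ (10 * m / ν) ^ 2 * EP + 1)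
    (n : ℕ) (hn1 : 1 ≤ n) (hnT : n ≤ T + 1) : ∑ i, ogdState η G n i ≤ 4 * m / ν := by
  induction n using Nat.strong_induction_on with
  | _ n ih =>
  have hm' : (1 : ℝ) ≤ m := by exact_mod_cast hm
  set S : ℕ → ℝ := fun t => ∑ i, ogdState η G t i with hS
  have hSn : ∀ t, 0 ≤ S t := fun t => Finset.sum_nonneg fun i _ => ogdState_nonneg _ _ _ _
  by_cases hc : ν * S n ≤ 1
  · show S n ≤ _
    rw [le_div_iff₀ hν]
    linarith
  have hS1 : S 1 = 0 := by simp [hS, hz]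
  have hn : n ≠ 1 := by
    rintro rfl
    rw [hS1] at hc
    simp at hc
  have hex : ∃ a, (1 ≤ a ∧ a < n ∧ ν * S a ≤ 1) ∧ ∀ t, a < t → t < n → 1 < ν * S t := by
    have hne : ((Finset.Ico 1 n).filter (fun a => ν * S a ≤ 1)).Nonempty :=
      ⟨1, by simp [hS1]; omega⟩
    obtain ⟨a, ha, hmax⟩ := Finset.exists_max_image _ id hne
    simp only [Finset.mem_filter, Finset.mem_Ico] at ha hmax
    refine ⟨a, ⟨ha.1.1, ha.1.2, ha.2⟩, fun t hat htn => ?_⟩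
    by_contra hcon
    have := hmax t ⟨⟨by omega, htn⟩, not_lt.1 hcon⟩
    simp only [id] at this
    omega
  obtain ⟨a, ⟨ha1, han, haS⟩, hat⟩ := hex
  obtain ⟨b, rfl⟩ : ∃ b, n = b + 1 := ⟨n - 1, by omega⟩
  have hr := hreg a b ha1 (by omega) (by omega)
    (fun t ht => by
      rw [Finset.mem_Icc] at ht
      exact ih t (by omega) (by omega) (by omega))
    (fun t ht h => by
      rw [Finset.mem_Icc] at ht
      exact hat t h (by omega))
  have ho := ogd_sum η G hG 0 (fun _ => le_rfl) a (b + 1) (by omega)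
  have hI : Finset.Ico a (b + 1) = Finset.Icc a b := by
    ext t; simp only [Finset.mem_Ico, Finset.mem_Icc]; omega
  rw [hI] at ho
  simp only [Pi.zero_apply, sub_zero] at ho
  have hcs : S (b + 1) ^ 2 ≤ m * ∑ i, ogdState η G (b + 1) i ^ 2 := by
    have := sq_sum_le_card_mul_sum_sq (s := Finset.univ) (f := fun i => ogdState η G (b + 1) i)
    simpa using this
  have hsq : ∑ i, ogdState η G a i ^ 2 ≤ S a ^ 2 :=
    Finset.sum_sq_le_sq_sum_of_nonneg fun i _ => ogdState_nonneg _ _ _ _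
  have hSa : S a ^ 2 ≤ 1 / ν ^ 2 := by
    rw [le_div_iff₀ (by positivity)]
    have := mul_nonneg hν.le (hSn a)
    nlinarith
  have hlen : (((b + 1 : ℕ) : ℝ) - a) ≤ T := by
    have h1 : (1 : ℝ) ≤ a := by exact_mod_cast ha1
    have h2 : ((b + 1 : ℕ) : ℝ) ≤ T + 1 := by exact_mod_cast hnT
    linarith
  have hX : 4 * m * η ^ 2 * (((b + 1 : ℕ) : ℝ) - a) ≤ 4 * m * η ^ 2 * T :=
    mul_le_mul_of_nonneg_left hlen (by positivity)
  have hY : 2 * η * ∑ t ∈ Finset.Icc a b, ∑ i, ogdState η G t i * G t i ≤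
      2 * η * ((10 * m / ν) ^ 2 * EP + 1) :=
    mul_le_mul_of_nonneg_left hr (by positivity)
  have hmain : ∑ i, ogdState η G (b + 1) i ^ 2 ≤
      1 / ν ^ 2 + 2 * η * ((10 * m / ν) ^ 2 * EP + 1) + 4 * m * η ^ 2 * T := by linarith
  have hw : 1 ≤ 4 * (1 / ν ^ 2) := by
    rw [mul_one_div, le_div_iff₀ (by positivity)]
    nlinarith
  set w := 1 / ν ^ 2 with hwdef
  have hL : (10 * m / ν) ^ 2 = 100 * m ^ 2 * w := by
    rw [hwdef]; field_simp; norm_num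
  have hgoal : (4 * m / ν) ^ 2 = 16 * m ^ 2 * w := by
    rw [hwdef]; field_simp; norm_num
  have hw0 : 0 < w := by positivity
  rw [hL] at hmain
  have h3 : S (b + 1) ^ 2 ≤ (4 * m / ν) ^ 2 := by
    rw [hgoal]
    exact ogd_arith _ _ _ _ _ _ _ hm' hη1 hηE hηT hw hw0 hcs hmain
  exact (le_abs_self _).trans (abs_le_of_sq_le_sq h3 (by positivity))


set_option maxHeartbeats 4000000 in
/-- Corollary 5.5 (adversarial case, unknown replenishment factor). There exist absolute
constants `k₁, k₂, k₃ > 0` such that: whenever the dual multipliers are produced by online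
gradient ascent on `ℝ_{≥0}^m` run on the subsequence of rounds in `T_G` with step size
`η = (k₁·E + k₂·m·E_P + 2m·√T)⁻¹`, and the primal satisfies the weakly-adaptive regret
guarantee with unknown payoff range (regret at most `L²·E_P` on every interval of
consecutive rounds of `T_G` whose Lagrangian payoffs are bounded by `L`), then with
`α := ν/(1+β)`,
`∑_{t=1}^T f_t(x_t) ≥ α · sup_x ∑_{t=1}^T f_t(x) − k₃·(m⁴/ν²)·(E_P + E + √T)`. -/
theorem stmt_11 :
    ∃ k₁ k₂ k₃ : ℝ, 0 < k₁ ∧ 0 < k₂ ∧ 0 < k₃ ∧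
      ∀ (T m : ℕ), 1 ≤ T → 1 ≤ m →
      ∀ (X : Type) (_ : Nonempty X) (x₀ : X)
        (β ρ : ℝ), 0 ≤ β → 0 < ρ → ρ ≤ 1 →
      ∀ (f : ℕ → X → ℝ),
        (∀ t ∈ Finset.Icc 1 T, ∀ x, 0 ≤ f t x) →
        (∀ t ∈ Finset.Icc 1 T, ∀ x, f t x ≤ 1) →
      ∀ (c : ℕ → X → Fin m → ℝ),
        (∀ t ∈ Finset.Icc 1 T, ∀ x i, |c t x i| ≤ 1) →
        (∀ t ∈ Finset.Icc 1 T, ∀ i, c t x₀ i ≤ -β) →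
      ∀ (x : ℕ → X) (lam : ℕ → Fin m → ℝ),
        (∀ t ∈ Finset.Icc 1 T, ∀ i, 0 ≤ lam t i) →
      ∀ (Bud : ℕ → Fin m → ℝ),
        (∀ i, Bud 1 i = T * ρ) →
        (∀ t ∈ Finset.Icc 1 T, ∀ i, Bud (t + 1) i = Bud t i - c t (x t) i) →
      ∀ (T0 TG : Finset ℕ),
        (∀ t, t ∈ T0 ↔ t ∈ Finset.Icc 1 T ∧ ∃ i, Bud t i < 1) →
        TG = Finset.Icc 1 T \ T0 →
        (∀ t ∈ T0, x t = x₀) →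
      ∀ (E EP η : ℝ), 0 ≤ E → 0 ≤ EP →
        η = (k₁ * E + k₂ * m * EP + 2 * m * Real.sqrt T)⁻¹ →
        -- OGD on the subsequence of rounds in T_G: zero at the first round of T_G,
        (∀ t ∈ TG, (∀ s ∈ TG, t ≤ s) → ∀ i, lam t i = 0) →
        -- and projected gradient steps between consecutive rounds of T_G
        (∀ t ∈ TG, ∀ t' ∈ TG, t < t' → (∀ s ∈ TG, s ≤ t ∨ t' ≤ s) →
          ∀ i, lam t' i = max 0 (lam t i + η * (c t (x t) i - ρ))) →
        -- weakly-adaptive primal regret with unknown payoff range (Assumption 5.1)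
        (∀ a b : ℕ, ∀ L : ℝ, 0 < L →
          (∀ t ∈ TG ∩ Finset.Icc a b, ∀ x' : X,
            |f t x' + ∑ i, lam t i * (ρ - c t x' i)| ≤ L) →
          ∀ x' : X, ∀ p : ℝ, 0 ≤ p → p ≤ 1 →
            p * (∑ t ∈ TG ∩ Finset.Icc a b, (f t x' + ∑ i, lam t i * (ρ - c t x' i)))
              + (1 - p) * (∑ t ∈ TG ∩ Finset.Icc a b,
                  (f t x₀ + ∑ i, lam t i * (ρ - c t x₀ i)))
              - ∑ t ∈ TG ∩ Finset.Icc a b,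
                  (f t (x t) + ∑ i, lam t i * (ρ - c t (x t) i)) ≤ L ^ 2 * EP) →
      ∑ t ∈ Finset.Icc 1 T, f t (x t) ≥
        ((β + ρ) / (1 + β)) * (⨆ x' : X, ∑ t ∈ Finset.Icc 1 T, f t x')
          - k₃ * ((m : ℝ) ^ 4 / (β + ρ) ^ 2) * (EP + E + Real.sqrt T) := by
  refine ⟨1, 100, 2000, one_pos, by norm_num, by norm_num, ?_⟩
  intro T m hT hm X _ x₀ β ρ hβ hρ hρ1 f hf0 hf1 c hc hc0 x lam hlam Bud hB1 hB T0 TG hT0 hTG hx0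
    E EP η hE hEP hη hfirst hstep hreg
  set ν : ℝ := β + ρ with hνdef
  have hν : 0 < ν := by positivity
  have hm' : (1 : ℝ) ≤ m := by exact_mod_cast hm
  have hT' : (1 : ℝ) ≤ T := by exact_mod_cast hT
  set R := Real.sqrt T with hR
  have hR1 : 1 ≤ R := Real.one_le_sqrt.2 hT'
  have hRR : R * R = T := Real.mul_self_sqrt (by positivity)
  set D : ℝ := E + 100 * m * EP + 2 * m * R with hD
  have hmR : 1 ≤ m * R := one_le_mul_of_one_le_of_one_le hm' hR1
  have hmE : 0 ≤ m * EP := by positivity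
  have hD2 : 2 ≤ D := by rw [hD]; linarith
  have hηD : η = D⁻¹ := by rw [hη, hD]; ring
  have hη0 : 0 < η := by rw [hηD]; positivity
  have hηD1 : η * D = 1 := by rw [hηD]; exact inv_mul_cancel₀ (by positivity)
  have hβ1 : β ≤ 1 := by
    have h1 := hc0 1 (by simp; omega) ⟨0, hm⟩
    have h2 := abs_le.1 (hc 1 (by simp; omega) x₀ ⟨0, hm⟩)
    linarith [h2.1]
  have hν2 : ν ≤ 2 := by rw [hνdef]; linarith
  have hη1 : 2 * η ≤ 1 := by
    have := mul_le_mul_of_nonneg_left hD2 hη0.le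
    linarith
  have hηe : 0 ≤ η * E := by positivity
  have hηep : 0 ≤ η * (m * EP) := by positivity
  have hηr : 0 ≤ η * (m * R) := by positivity
  have hηexp : η * E + 100 * (η * (m * EP)) + 2 * (η * (m * R)) = 1 := by
    rw [← hηD1, hD]; ring
  have hηE : 100 * m * (η * EP) ≤ 1 := by linarith
  have hηR : 2 * (η * (m * R)) ≤ 1 := by linarith
  have hηT : 4 * m * (m * η ^ 2 * T) ≤ m := by
    have : 4 * m * (m * η ^ 2 * T) = (2 * (η * (m * R))) ^ 2 := by rw [← hRR]; ring
    rw [this]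
    exact (pow_le_one₀ (by positivity) hηR).trans hm'
  set G : ℕ → Fin m → ℝ := fun t i => if t ∈ TG then c t (x t) i - ρ else 0 with hGdef
  have hTGT : ∀ t ∈ TG, t ∈ Finset.Icc 1 T := fun t ht => by
    rw [hTG] at ht; exact (Finset.mem_sdiff.1 ht).1
  have hG : ∀ t i, |G t i| ≤ 2 := by
    intro t i
    simp only [hGdef]
    split_ifs with h
    · have := abs_le.1 (hc t (hTGT t h) (x t) i)
      rw [abs_le]; constructor <;> linarith [this.1, this.2]
    · simp
  set μ := ogdState η G with hμ
  have hμ0 : ∀ t i, 0 ≤ μ t i := ogdState_nonneg η G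
  have hag : ∀ t ∈ TG, ∀ i, lam t i = μ t i := fun t ht i =>
    ogd_agree η (fun t i => c t (x t) i - ρ) G TG lam (fun t i => rfl) hfirst hstep t ht i
  have h0TG : 0 ∉ TG := fun h => by have := hTGT 0 h; simp at this
  have hz : ∀ i, μ 1 i = 0 := by
    intro i
    simp [hμ, ogdState, hGdef, h0TG]
  have hLabs : ∀ t ∈ TG, ∀ x', |f t x' + ∑ i, lam t i * (ρ - c t x' i)| ≤ 1 + 2 * ∑ i, μ t i := by
    intro t ht x'
    have ht' := hTGT t ht
    have h1 : |∑ i, lam t i * (ρ - c t x' i)| ≤ 2 * ∑ i, μ t i := by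
      rw [Finset.mul_sum]
      refine (Finset.abs_sum_le_sum_abs _ _).trans (Finset.sum_le_sum fun i _ => ?_)
      rw [abs_mul, hag t ht, abs_of_nonneg (hμ0 t i), mul_comm]
      apply mul_le_mul_of_nonneg_right _ (hμ0 t i)
      have := abs_le.1 (hc t ht' x' i)
      rw [abs_le]; constructor <;> linarith [this.1, this.2]
    refine (abs_add_le _ _).trans (add_le_add ?_ h1)
    rw [abs_of_nonneg (hf0 t ht' x')]
    exact hf1 t ht' x'
  have hLx0 : ∀ t ∈ TG, ν * ∑ i, μ t i ≤ f t x₀ + ∑ i, lam t i * (ρ - c t x₀ i) := by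
    intro t ht
    have ht' := hTGT t ht
    have : ν * ∑ i, μ t i ≤ ∑ i, lam t i * (ρ - c t x₀ i) := by
      rw [Finset.mul_sum]
      refine Finset.sum_le_sum fun i _ => ?_
      rw [hag t ht, mul_comm]
      apply mul_le_mul_of_nonneg_left _ (hμ0 t i)
      have := hc0 t ht' i
      linarith
    linarith [hf0 t ht' x₀]
  have hLxt : ∀ t ∈ TG, f t (x t) + ∑ i, lam t i * (ρ - c t (x t) i)
      = f t (x t) - ∑ i, μ t i * G t i := by
    intro t ht
    rw [sub_eq_add_neg, ← Finset.sum_neg_distrib]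
    congr 1
    refine Finset.sum_congr rfl fun i _ => ?_
    simp only [hGdef, if_pos ht, hag t ht]
    ring
  have hsumG : ∀ a b : ℕ, ∑ t ∈ TG ∩ Finset.Icc a b, ∑ i, μ t i * G t i
      = ∑ t ∈ Finset.Icc a b, ∑ i, μ t i * G t i := by
    intro a b
    refine Finset.sum_subset Finset.inter_subset_right fun t ht hn => ?_
    have : t ∉ TG := fun h => hn (Finset.mem_inter.2 ⟨h, ht⟩)
    simp [hGdef, this]
  have hL0 : 0 < 10 * (m : ℝ) / ν := by positivity
  have hLb : ∀ s : ℝ, s ≤ 4 * m / ν → 1 + 2 * s ≤ 10 * m / ν := by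
    intro s hs
    have h1 : 1 ≤ 2 * (m / ν) := by
      rw [← mul_div_assoc, le_div_iff₀ hν]; linarith
    have h2 : 4 * (m : ℝ) / ν = 4 * (m / ν) := by ring
    have h3 : 10 * (m : ℝ) / ν = 10 * (m / ν) := by ring
    rw [h2] at hs
    rw [h3]
    linarith
  have hbd : ∀ n, 1 ≤ n → n ≤ T + 1 → ∑ i, μ n i ≤ 4 * m / ν := by
    refine fun n h1 h2 => ogd_bound hm η ν EP T hη0.le hν hν2 hη1 hηE hηT G hG hz ?_ n h1 h2
    intro a b ha hab hb hSM hSbig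
    have hr := hreg a b (10 * m / ν) hL0 (fun t ht x' => by
      have ht' := Finset.mem_inter.1 ht
      exact (hLabs t ht'.1 x').trans (hLb _ (hSM t ht'.2))) x₀ 0 le_rfl zero_le_one
    rw [zero_mul, zero_add, sub_zero, one_mul, ← Finset.sum_sub_distrib] at hr
    rw [← hsumG]
    have h1 : ∑ t ∈ TG ∩ Finset.Icc a b, ∑ i, μ t i * G t i ≤
        ∑ t ∈ TG ∩ Finset.Icc a b, (((f t x₀ + ∑ i, lam t i * (ρ - c t x₀ i))
          - (f t (x t) + ∑ i, lam t i * (ρ - c t (x t) i))) + if t = a then 1 else 0) := by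
      refine Finset.sum_le_sum fun t ht => ?_
      have ht' := Finset.mem_inter.1 ht
      have e1 := hLx0 t ht'.1
      rw [hLxt t ht'.1]
      have e2 := hf1 t (hTGT t ht'.1) (x t)
      have e3 : 0 ≤ ν * ∑ i, μ t i := mul_nonneg hν.le (Finset.sum_nonneg fun i _ => hμ0 t i)
      split_ifs with hta
      · linarith
      · have := hSbig t ht'.2 (lt_of_le_of_ne (Finset.mem_Icc.1 ht'.2).1 (Ne.symm hta))
        change 1 < ν * ∑ i, μ t i at this
        linarith
    rw [Finset.sum_add_distrib] at h1
    have h2 : ∑ t ∈ TG ∩ Finset.Icc a b, (if t = a then (1 : ℝ) else 0) ≤ 1 := by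
      rw [Finset.sum_ite_eq']
      split_ifs <;> norm_num
    linarith
  have hbsq : ∀ n, 1 ≤ n → n ≤ T + 1 → ∑ i, μ n i ^ 2 ≤ (4 * m / ν) ^ 2 := by
    intro n h1 h2
    refine (Finset.sum_sq_le_sq_sum_of_nonneg fun i _ => hμ0 n i).trans ?_
    exact pow_le_pow_left₀ (Finset.sum_nonneg fun i _ => hμ0 n i) (hbd n h1 h2) 2
  set α : ℝ := ν / (1 + β) with hα
  have hβp : 0 < 1 + β := by linarith
  have hα0 : 0 < α := by positivity
  have hαν : α * (1 + β) = ν := div_mul_cancel₀ _ hβp.ne'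
  have hα1 : α ≤ 1 := by rw [hα, div_le_one hβp, hνdef]; linarith
  set A := ∑ t ∈ Finset.Icc 1 T, ∑ i, μ t i * G t i with hA
  have hdual : α * T0.card - 3 - (1 + (4 * m / ν) ^ 2) / 2 * D - R ≤ A := by
    have hkey : ∀ K Q : ℝ, 0 ≤ Q → Q ≤ 1 + (4 * m / ν) ^ 2 →
        0 ≤ Q + 2 * η * (A - K) + 4 * m * η ^ 2 * T →
        K - (1 + (4 * m / ν) ^ 2) / 2 * D - R ≤ A := by
      intro K Q hQ0 hQ h
      have h1 := mul_nonneg h (by linarith : 0 ≤ D)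
      have h2 : (Q + 2 * η * (A - K) + 4 * m * η ^ 2 * T) * D
          = Q * D + (η * D) * (2 * (A - K) + 2 * (2 * (η * (m * R))) * R) := by
        rw [← hRR]; ring
      rw [h2, hηD1] at h1
      have h3 := mul_le_mul_of_nonneg_right hQ (by linarith : 0 ≤ D)
      have h4 := mul_le_mul_of_nonneg_right hηR (by linarith : 0 ≤ R)
      linarith
    have hIcc : ∀ a, Finset.Ico a (T + 1) = Finset.Icc a T := by
      intro a; ext t; simp only [Finset.mem_Ico, Finset.mem_Icc]; omega
    rcases T0.eq_empty_or_nonempty with hemp | hne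
    · have ho := ogd_sum η G hG 0 (fun _ => le_rfl) 1 (T + 1) (by omega)
      rw [hIcc, ← hμ] at ho
      simp only [Pi.zero_apply, sub_zero, hz] at ho
      rw [← hA] at ho
      have h0 : 0 ≤ ∑ i, μ (T + 1) i ^ 2 := Finset.sum_nonneg fun i _ => sq_nonneg _
      push_cast at ho
      have := hkey 0 0 le_rfl (by positivity) (by
        norm_num at ho ⊢
        linarith)
      rw [hemp, Finset.card_empty]
      push_cast
      linarith
    · obtain ⟨τ, hτ, hmax⟩ := Finset.exists_max_image T0 id hne
      simp only [id] at hmax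
      obtain ⟨hτT, i, hBi⟩ := (hT0 τ).1 hτ
      obtain ⟨hτ1, hτT⟩ := Finset.mem_Icc.1 hτT
      set κ : ℝ := 1 / (1 + β) with hκ
      have hκ0 : 0 < κ := by positivity
      have hκ1 : κ ≤ 1 := by rw [hκ, div_le_one hβp]; linarith
      have hκν : κ * ν = α := by rw [hκ, hα]; ring
      have hbud : ∀ n, 1 ≤ n → n ≤ T → Bud n i = T * ρ - ∑ t ∈ Finset.Ico 1 n, c t (x t) i := by
        intro n hn
        induction n, hn using Nat.le_induction with
        | base => intro _; simp [hB1]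
        | succ n hn ih =>
          intro hnT
          rw [hB n (Finset.mem_Icc.2 ⟨hn, by omega⟩), ih (by omega), Finset.sum_Ico_succ_top hn]
          ring
      have hb := hbud τ hτ1 hτT
      have hGlow : ∀ t ∈ Finset.Ico 1 τ,
          c t (x t) i - ρ + (if t ∈ T0 then ν else 0) ≤ G t i := by
        intro t ht
        have ht' : t ∈ Finset.Icc 1 T := by
          simp only [Finset.mem_Ico, Finset.mem_Icc] at ht ⊢; omega
        by_cases h : t ∈ T0
        · have hn : t ∉ TG := by rw [hTG]; simp [h]
          have := hc0 t ht' i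
          simp only [hGdef, if_neg hn, if_pos h, hx0 t h]
          linarith
        · have hn : t ∈ TG := by rw [hTG]; exact Finset.mem_sdiff.2 ⟨ht', h⟩
          simp only [hGdef, if_pos hn, if_neg h]
          linarith
      have hGs := Finset.sum_le_sum hGlow
      rw [Finset.sum_add_distrib, Finset.sum_sub_distrib, Finset.sum_const, Nat.card_Ico,
        ← Finset.sum_filter, Finset.sum_const, nsmul_eq_mul, nsmul_eq_mul] at hGs
      have hcard : (T0.card : ℝ) ≤ ((Finset.Ico 1 τ).filter (· ∈ T0)).card + 1 := by
        have hsub : T0 ⊆ insert τ ((Finset.Ico 1 τ).filter (· ∈ T0)) := by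
          intro t ht
          have h1 := hmax t ht
          have h2 := Finset.mem_Icc.1 ((hT0 t).1 ht).1
          simp only [Finset.mem_insert, Finset.mem_filter, Finset.mem_Ico]
          by_cases h : t = τ
          · exact Or.inl h
          · exact Or.inr ⟨⟨h2.1, by omega⟩, ht⟩
        have := (Finset.card_le_card hsub).trans (Finset.card_insert_le _ _)
        exact_mod_cast this
      have hcn := mul_le_mul_of_nonneg_right hcard hν.le
      have hτr : ((τ - 1 : ℕ) : ℝ) ≤ T := by exact_mod_cast (by omega : τ - 1 ≤ T)
      have hτρ := mul_le_mul_of_nonneg_right hτr hρ.le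
      have hGi : ν * T0.card - 3 ≤ ∑ t ∈ Finset.Ico 1 τ, G t i := by linarith
      have hGκ := mul_le_mul_of_nonneg_left hGi hκ0.le
      have hKlow : α * T0.card - 3 ≤ κ * ∑ t ∈ Finset.Ico 1 τ, G t i := by
        rw [← hκν]; linarith
      have ho1 := ogd_sum η G hG (Pi.single i κ)
        (fun j => by
          by_cases h : j = i
          · subst h; simp [hκ0.le]
          · simp [h]) 1 τ hτ1
      have ho2 := ogd_sum η G hG 0 (fun _ => le_rfl) τ (T + 1) (by omega)
      rw [hIcc, ← hμ] at ho2
      rw [← hμ] at ho1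
      simp only [Pi.zero_apply, sub_zero] at ho2
      have e1 : ∑ j, (μ 1 j - (Pi.single i κ : Fin m → ℝ) j) ^ 2 = κ ^ 2 := by
        simp [hz, Pi.single_apply]
      have e2 : ∑ t ∈ Finset.Ico 1 τ, ∑ j, (μ t j - (Pi.single i κ : Fin m → ℝ) j) * G t j
          = ∑ t ∈ Finset.Ico 1 τ, ∑ j, μ t j * G t j - κ * ∑ t ∈ Finset.Ico 1 τ, G t i := by
        rw [Finset.mul_sum, ← Finset.sum_sub_distrib]
        refine Finset.sum_congr rfl fun t _ => ?_
        simp [sub_mul, Finset.sum_sub_distrib, Pi.single_apply]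
      have e3 : A = ∑ t ∈ Finset.Ico 1 τ, ∑ j, μ t j * G t j
          + ∑ t ∈ Finset.Icc τ T, ∑ j, μ t j * G t j := by
        rw [hA, ← hIcc, ← hIcc, Finset.sum_Ico_consecutive _ hτ1 (by omega)]
      rw [e1, e2] at ho1
      have p1 : 0 ≤ ∑ j, (μ τ j - (Pi.single i κ : Fin m → ℝ) j) ^ 2 :=
        Finset.sum_nonneg fun _ _ => sq_nonneg _
      have p2 : 0 ≤ ∑ j, μ (T + 1) j ^ 2 := Finset.sum_nonneg fun _ _ => sq_nonneg _
      have p3 := hbsq τ hτ1 (by omega)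
      have p4 : κ ^ 2 ≤ 1 := pow_le_one₀ hκ0.le hκ1
      push_cast at ho1 ho2
      have := hkey (κ * ∑ t ∈ Finset.Ico 1 τ, G t i) (κ ^ 2 + (4 * m / ν) ^ 2) (by positivity)
        (by linarith) (by rw [e3]; linarith)
      linarith
  have hfinal : ∀ x' : X, α * ∑ t ∈ Finset.Icc 1 T, f t x' ≤ ∑ t ∈ Finset.Icc 1 T, f t (x t)
      + 2000 * ((m : ℝ) ^ 4 / ν ^ 2) * (EP + E + R) := by
    intro x'
    have hr := hreg 1 T (10 * m / ν) hL0 (fun t ht y => by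
      have ht' := Finset.mem_inter.1 ht
      have ht2 := Finset.mem_Icc.1 ht'.2
      exact (hLabs t ht'.1 y).trans (hLb _ (hbd t ht2.1 (by omega)))) x' α hα0.le hα1
    have hI : TG ∩ Finset.Icc 1 T = TG := Finset.inter_eq_left.2 hTGT
    have hs := hsumG 1 T
    rw [← hA] at hs
    rw [hI] at hr hs
    rw [Finset.sum_congr rfl hLxt, Finset.sum_sub_distrib, hs, Finset.mul_sum, Finset.mul_sum,
      ← Finset.sum_add_distrib] at hr
    have hmix : ∑ t ∈ TG, α * f t x' ≤ ∑ t ∈ TG, (α * (f t x' + ∑ i, lam t i * (ρ - c t x' i))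
        + (1 - α) * (f t x₀ + ∑ i, lam t i * (ρ - c t x₀ i))) := by
      refine Finset.sum_le_sum fun t ht => ?_
      have ht' := hTGT t ht
      have h1 := mul_le_mul_of_nonneg_left (hLx0 t ht) (by linarith : 0 ≤ 1 - α)
      have h2 : -(1 - ρ) * ∑ i, μ t i ≤ ∑ i, lam t i * (ρ - c t x' i) := by
        rw [Finset.mul_sum]
        refine Finset.sum_le_sum fun i _ => ?_
        rw [hag t ht, mul_comm]
        apply mul_le_mul_of_nonneg_left _ (hμ0 t i)
        linarith [(abs_le.1 (hc t ht' x' i)).2]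
      have h3 := mul_le_mul_of_nonneg_left h2 hα0.le
      have h4 : α * (-(1 - ρ) * ∑ i, μ t i) + (1 - α) * (ν * ∑ i, μ t i) = 0 := by
        have : α * (-(1 - ρ) * ∑ i, μ t i) + (1 - α) * (ν * ∑ i, μ t i)
          = (ν - α * (1 - ρ + ν)) * ∑ i, μ t i := by ring
        rw [this, hνdef, show 1 - ρ + (β + ρ) = 1 + β by ring, hαν, hνdef]
        ring
      linarith
    have hT0sub : T0 ⊆ Finset.Icc 1 T := fun t ht => ((hT0 t).1 ht).1
    have hsplit : ∀ g : ℕ → ℝ, ∑ t ∈ Finset.Icc 1 T, g t = ∑ t ∈ TG, g t + ∑ t ∈ T0, g t := by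
      intro g
      rw [hTG, Finset.sum_sdiff hT0sub]
    have hT0f : ∑ t ∈ T0, α * f t x' ≤ α * T0.card := by
      have : ∑ t ∈ T0, α * f t x' ≤ ∑ t ∈ T0, α := by
        refine Finset.sum_le_sum fun t ht => ?_
        have := mul_le_mul_of_nonneg_left (hf1 t (hT0sub ht) x') hα0.le
        linarith
      rw [Finset.sum_const, nsmul_eq_mul] at this
      linarith
    have hT0p : 0 ≤ ∑ t ∈ T0, f t (x t) := Finset.sum_nonneg fun t ht => hf0 t (hT0sub ht) _
    rw [Finset.mul_sum, hsplit, hsplit (fun t => f t (x t))]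
    have herr : (10 * m / ν) ^ 2 * EP + 3 + (1 + (4 * m / ν) ^ 2) / 2 * D + R ≤
        2000 * ((m : ℝ) ^ 4 / ν ^ 2) * (EP + E + R) := by
      have hw : 1 ≤ 4 * (1 / ν ^ 2) := by
        rw [mul_one_div, le_div_iff₀ (by positivity)]
        nlinarith
      have g1 : (10 * m / ν) ^ 2 = 100 * (m ^ 2 * (1 / ν ^ 2)) := by ring
      have g2 : (4 * m / ν) ^ 2 = 16 * (m ^ 2 * (1 / ν ^ 2)) := by ring
      have g3 : (m : ℝ) ^ 4 / ν ^ 2 = m ^ 4 * (1 / ν ^ 2) := by ring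
      rw [g1, g2, g3]
      set w := 1 / ν ^ 2
      have hw0 : 0 < w := by positivity
      set Z := EP + E + R with hZ
      have hZ0 : 0 ≤ Z := by positivity
      have hDZ : D ≤ 100 * (m * Z) := by
        have : E ≤ m * E := le_mul_of_one_le_left hE hm'
        have : 0 ≤ m * R := by positivity
        rw [hD, hZ]
        linarith [mul_nonneg (by positivity : (0 : ℝ) ≤ m) hE]
      have q2 : w ≤ m ^ 2 * w := le_mul_of_one_le_left hw0.le (one_le_pow₀ hm')
      have q4 : m ^ 2 * w ≤ m ^ 4 * w :=
        mul_le_mul_of_nonneg_right (pow_le_pow_right₀ hm' (by norm_num)) hw0.le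
      have q3 : m ^ 3 * w ≤ m ^ 4 * w :=
        mul_le_mul_of_nonneg_right (pow_le_pow_right₀ hm' (by norm_num)) hw0.le
      have s1 : m ^ 2 * w * EP ≤ m ^ 4 * w * Z :=
        mul_le_mul q4 (by rw [hZ]; linarith) hEP (by positivity)
      have s2 : 3 + R ≤ 16 * (m ^ 4 * w * Z) := by
        have : R * 1 ≤ Z * (4 * (m ^ 4 * w)) :=
          mul_le_mul (by rw [hZ]; linarith) (by linarith) zero_le_one hZ0
        linarith
      have s3 : (1 + 16 * (m ^ 2 * w)) / 2 * D ≤ 10 * (m ^ 2 * w) * (100 * (m * Z)) :=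
        mul_le_mul (by linarith) hDZ (by linarith) (by positivity)
      have s4 : m ^ 3 * w * Z ≤ m ^ 4 * w * Z := mul_le_mul_of_nonneg_right q3 hZ0
      have s5 : 0 ≤ m ^ 4 * w * Z := by positivity
      linarith
    linarith
  have hsup : (⨆ x' : X, ∑ t ∈ Finset.Icc 1 T, f t x') ≤ (∑ t ∈ Finset.Icc 1 T, f t (x t)
      + 2000 * ((m : ℝ) ^ 4 / ν ^ 2) * (EP + E + R)) / α := by
    refine ciSup_le fun x' => ?_
    rw [le_div_iff₀ hα0, mul_comm]
    exact hfinal x'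
  rw [le_div_iff₀ hα0, mul_comm] at hsup
  linarith
end
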